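/- The function p is differentiable at every x ∈ ℝ with derivative parity(x − 1); consequently p is monotone nondecreasing and continuous on ℝ. Moreover, for every n ∈ ℤ, p(2n+1) = n, p(2n+2) = n+1, and for every x ∈ [2n+1, 2n+2] one has n ≤ p(x) ≤ n+1; thus on each odd interval [2n+1, 2n+2], p grows continuously and monotonically from n to n+1. -/

import Mathlib

noncomputable def parity (x : ℝ) : ℝ := max 0 (Real.pi / 2 * Real.sin (Real.pi * x))

noncomputable def pfun (x : ℝ) : ℝ := ∫ t in (0:ℝ)..(x - 1), parity t

theorem continuous_parity : Continuous parity := by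
  unfold parity
  fun_prop

theorem parity_nonneg (x : ℝ) : 0 ≤ parity x := le_max_left _ _

theorem periodic_parity : Function.Periodic parity 2 := fun x => by
  have h : Real.pi * (x + 2) = Real.pi * x + 2 * Real.pi := by ring
  rw [parity, parity, h, Real.sin_add_two_pi]

theorem integral_parity_zero_one : ∫ t in (0:ℝ)..1, parity t = 1 := by
  have h : Set.EqOn parity (fun t => Real.pi / 2 * Real.sin (Real.pi * t)) (Set.uIcc 0 1) := by
    intro t ht
    rw [Set.uIcc_of_le zero_le_one] at ht
    refine max_eq_right (mul_nonneg (by positivity) ?_)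
    exact Real.sin_nonneg_of_nonneg_of_le_pi (mul_nonneg Real.pi_pos.le ht.1)
      (mul_le_of_le_one_right Real.pi_pos.le ht.2)
  rw [intervalIntegral.integral_congr h, intervalIntegral.integral_const_mul,
    intervalIntegral.integral_comp_mul_left _ Real.pi_ne_zero]
  simp only [mul_zero, mul_one, integral_sin, Real.cos_zero, Real.cos_pi, smul_eq_mul]
  field_simp
  norm_num

theorem integral_parity_one_two : ∫ t in (1:ℝ)..2, parity t = 0 := by
  have h : Set.EqOn parity (fun _ => 0) (Set.uIcc 1 2) := by
    intro t ht
    rw [Set.uIcc_of_le one_le_two] at ht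
    refine max_eq_left (mul_nonpos_of_nonneg_of_nonpos (by positivity) ?_)
    rw [← Real.sin_sub_two_pi]
    exact Real.sin_nonpos_of_nonpos_of_neg_pi_le (by nlinarith [Real.pi_pos, ht.2])
      (by nlinarith [Real.pi_pos, ht.1])
  rw [intervalIntegral.integral_congr h, intervalIntegral.integral_zero]

theorem integral_parity_add_zsmul (a : ℝ) (n : ℤ) : ∫ t in a..(a + n • (2:ℝ)), parity t = n := by
  have h : ∫ t in (0:ℝ)..2, parity t = 1 := by
    rw [← intervalIntegral.integral_add_adjacent_intervals
      (continuous_parity.intervalIntegrable 0 1) (continuous_parity.intervalIntegrable 1 2),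
      integral_parity_zero_one, integral_parity_one_two, add_zero]
  rw [periodic_parity.intervalIntegral_add_zsmul_eq n a
      (fun _ _ => continuous_parity.intervalIntegrable _ _),
    periodic_parity.intervalIntegral_add_eq a 0, zero_add, h, zsmul_eq_mul, mul_one]

theorem hasDerivAt_pfun (x : ℝ) : HasDerivAt pfun (parity (x - 1)) x :=
  (continuous_parity.integral_hasStrictDerivAt 0 (x - 1)).hasDerivAt.comp_sub_const x 1

theorem monotone_pfun : Monotone pfun :=
  monotone_of_hasDerivAt_nonneg hasDerivAt_pfun fun x => parity_nonneg (x - 1)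

theorem pfun_two_mul_add_one (n : ℤ) : pfun (2 * n + 1) = n := by
  have h : (2 * n + 1 - 1 : ℝ) = 0 + n • (2:ℝ) := by rw [zsmul_eq_mul]; ring
  rw [pfun, h, integral_parity_add_zsmul]

theorem pfun_two_mul_add_two (n : ℤ) : pfun (2 * n + 2) = n + 1 := by
  have h : (2 * n + 2 - 1 : ℝ) = 1 + n • (2:ℝ) := by rw [zsmul_eq_mul]; ring
  rw [pfun, h, ← intervalIntegral.integral_add_adjacent_intervals
    (continuous_parity.intervalIntegrable 0 1) (continuous_parity.intervalIntegrable 1 _),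
    integral_parity_zero_one, integral_parity_add_zsmul, add_comm]

theorem pfun_deriv_monotone_odd_intervals :
    (∀ x : ℝ, HasDerivAt pfun (parity (x - 1)) x) ∧
    Monotone pfun ∧ Continuous pfun ∧
    ∀ n : ℤ, pfun (2*n + 1) = n ∧ pfun (2*n + 2) = n + 1 ∧
      ∀ x ∈ Set.Icc ((2*n + 1 : ℝ)) (2*n + 2), (n : ℝ) ≤ pfun x ∧ pfun x ≤ n + 1 := by
  refine ⟨hasDerivAt_pfun, monotone_pfun,
    continuous_iff_continuousAt.2 fun x => (hasDerivAt_pfun x).continuousAt,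
    fun n => ⟨pfun_two_mul_add_one n, pfun_two_mul_add_two n, fun x hx => ⟨?_, ?_⟩⟩⟩
  · exact (pfun_two_mul_add_one n).symm.trans_le (monotone_pfun hx.1)
  · exact (monotone_pfun hx.2).trans_eq (pfun_two_mul_add_two n)
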